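/- arXiv:1108.3519 — 6 statements merged into one kernel-verified Lean document; each statement's English description precedes it below -/
import Mathlib

section
/- Let p ≥ 1, let (q_n) be a sequence of positive integers, and let (β_n), (γ_n) be sequences in 𝕋 such that Σ_{j≥1} j^{p+1}·‖β_j − γ_j‖ < ∞. Then the series (1/2)·Σ_{j≥1} [T(q_j x + β_j) − T(q_j x + γ_j)] converges for Lebesgue-almost every x ∈ 𝕋, and the function ψ defined almost everywhere as its sum satisfies ‖ψ‖_p^p ≤ 2·Σ_{j≥1} j^{p+1}·‖β_j − γ_j‖. -/
open MeasureTheory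

/-- The Haar function `T : 𝕋 → ℤ`, equal to `1` on `[0,1/2)` and `-1` on `[1/2,1)`. -/
noncomputable def haarT (x : UnitAddCircle) : ℤ :=
  if (AddCircle.equivIco 1 0 x : ℝ) < 1/2 then 1 else -1

theorem haarT_coe_eq_one {r : ℝ} (h0 : 0 ≤ r) (h1 : r < 1 / 2) :
    haarT (r : UnitAddCircle) = 1 := by
  unfold haarT
  rw [AddCircle.equivIco_coe_of_mem (p := (1 : ℝ)) (a := 0) (y := r) ⟨h0, by linarith⟩, if_pos h1]

theorem haarT_coe_eq_neg_one {r : ℝ} (h0 : 1 / 2 ≤ r) (h1 : r < 1) :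
    haarT (r : UnitAddCircle) = -1 := by
  unfold haarT
  rw [AddCircle.equivIco_coe_of_mem (p := (1 : ℝ)) (a := 0) (y := r)
    ⟨by linarith, by linarith⟩, if_neg (not_lt.mpr h0)]

theorem UnitAddCircle.norm_coe_le_abs_sub (x : ℝ) (n : ℤ) :
    ‖(x : UnitAddCircle)‖ ≤ |x - n| := by
  rw [UnitAddCircle.norm_eq]
  exact round_le x n

/-- `haarT` takes equal values at the ends of an arc which avoids its two jumps. -/
theorem haarT_sub_eq_haarT_add {z : UnitAddCircle} {e : ℝ} (h0 : |e| < ‖z‖)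
    (h1 : |e| < ‖z - ((1 / 2 : ℝ) : UnitAddCircle)‖) :
    haarT (z - (e : UnitAddCircle)) = haarT (z + (e : UnitAddCircle)) := by
  obtain ⟨r, ⟨hr0, hr1⟩, rfl⟩ : ∃ r : ℝ, (0 ≤ r ∧ r < 1) ∧ (r : UnitAddCircle) = z :=
    ⟨AddCircle.equivIco 1 0 z, ⟨(AddCircle.equivIco 1 0 z).2.1,
      by simpa using (AddCircle.equivIco 1 0 z).2.2⟩, AddCircle.coe_equivIco⟩
  rw [← AddCircle.coe_sub] at h1
  have ha := h0.trans_le (UnitAddCircle.norm_coe_le_abs_sub r 0)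
  have hb := h0.trans_le (UnitAddCircle.norm_coe_le_abs_sub r 1)
  have hc := h1.trans_le (UnitAddCircle.norm_coe_le_abs_sub _ 0)
  rw [Int.cast_zero, sub_zero, abs_of_nonneg hr0] at ha
  rw [Int.cast_one, abs_of_nonpos (a := r - 1) (by linarith)] at hb
  rw [Int.cast_zero, sub_zero] at hc
  have h2 := abs_le.mp (le_refl |e|)
  rw [← AddCircle.coe_sub, ← AddCircle.coe_add]
  rcases lt_abs.mp hc with h | h
  · rw [haarT_coe_eq_neg_one (by linarith) (by linarith),
      haarT_coe_eq_neg_one (by linarith) (by linarith)]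
  · rw [haarT_coe_eq_one (by linarith) (by linarith),
      haarT_coe_eq_one (by linarith) (by linarith)]

/-- The points where two translates of `haarT` differ lie in a set of measure at most twice the
length of the translation. -/
theorem exists_measurableSet_haarT_add_ne (b c : UnitAddCircle) :
    ∃ B : Set UnitAddCircle, MeasurableSet B ∧ volume B ≤ ENNReal.ofReal (2 * ‖b - c‖) ∧
      ∀ y, haarT (y + b) ≠ haarT (y + c) → y ∈ B := by
  obtain ⟨d, hd, hdn⟩ : ∃ d : ℝ, (d : UnitAddCircle) = b - c ∧ |d| = ‖b - c‖ := by
    obtain ⟨r, hr⟩ := QuotientAddGroup.mk_surjective (b - c)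
    refine ⟨r - round r, ?_, ?_⟩
    · rw [← hr, AddCircle.coe_sub, sub_eq_self]
      exact AddCircle.coe_eq_zero_iff _ |>.mpr ⟨round r, by simp⟩
    · rw [← hr]
      exact UnitAddCircle.norm_eq.symm
  have hsplit : (d : UnitAddCircle) = ((d / 2 : ℝ) : UnitAddCircle) + ((d / 2 : ℝ)) := by
    rw [← AddCircle.coe_add, add_halves]
  have hball (x : UnitAddCircle) :
      volume (Metric.closedBall x |d / 2|) ≤ ENNReal.ofReal ‖b - c‖ := by
    rw [AddCircle.volume_closedBall, ← hdn]
    refine ENNReal.ofReal_le_ofReal ((min_le_right _ _).trans_eq ?_)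
    rw [abs_div, abs_two]
    ring
  set t : UnitAddCircle := c + ((d / 2 : ℝ) : UnitAddCircle)
  refine ⟨(fun y => y + t) ⁻¹' (Metric.closedBall 0 |d / 2| ∪
    Metric.closedBall ((1 / 2 : ℝ) : UnitAddCircle) |d / 2|), ?_, ?_, ?_⟩
  · exact measurable_add_const t
      (Metric.isClosed_closedBall.measurableSet.union Metric.isClosed_closedBall.measurableSet)
  · rw [measure_preimage_add_right, two_mul, ENNReal.ofReal_add (norm_nonneg _) (norm_nonneg _)]
    exact (measure_union_le _ _).trans (add_le_add (hball _) (hball _))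
  · intro y hy
    by_contra hmem
    simp only [Set.mem_preimage, Set.mem_union, Metric.mem_closedBall, dist_eq_norm, sub_zero,
      not_or, not_le] at hmem
    refine hy ?_
    rw [show y + b = y + t + ((d / 2 : ℝ) : UnitAddCircle) by
        rw [add_assoc, add_assoc, ← hsplit, hd]; abel,
      show y + c = y + t - ((d / 2 : ℝ) : UnitAddCircle) by simp only [t]; abel]
    exact (haarT_sub_eq_haarT_add hmem.1 hmem.2).symm

theorem abs_half_mul_haarT_sub_le_one (x y : UnitAddCircle) :
    |(1 / 2 : ℝ) * ((haarT x : ℝ) - (haarT y : ℝ))| ≤ 1 := by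
  unfold haarT
  split_ifs <;> norm_num

theorem Finset.card_rpow_le_sum_rpow (S : Finset ℕ) {p : ℝ} (hp : 0 < p) :
    (S.card : ℝ) ^ p ≤ ∑ j ∈ S, ((j : ℝ) + 1) ^ (p + 1) := by
  rcases S.eq_empty_or_nonempty with rfl | hS
  · simp [Real.zero_rpow hp.ne']
  set m := S.max' hS
  have hcard : S.card ≤ m + 1 := by
    simpa using Finset.card_le_card (t := Finset.range (m + 1)) fun j hj =>
      Finset.mem_range_succ_iff.mpr (S.le_max' j hj)
  calc (S.card : ℝ) ^ p ≤ ((m : ℝ) + 1) ^ p :=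
        Real.rpow_le_rpow (by positivity) (by exact_mod_cast hcard) hp.le
    _ ≤ ((m : ℝ) + 1) ^ (p + 1) :=
        Real.rpow_le_rpow_of_exponent_le (by simp) (by linarith)
    _ ≤ ∑ j ∈ S, ((j : ℝ) + 1) ^ (p + 1) :=
        Finset.single_le_sum (f := fun j : ℕ => ((j : ℝ) + 1) ^ (p + 1))
          (fun j _ => by positivity) (S.max'_mem hS)

/-- if `Σ_{j≥1} j^(p+1) ‖β_j - γ_j‖ < ∞` (here the index `j : ℕ` stands for the
paper's index `j+1 ≥ 1`), then the series `(1/2) Σ_{j≥1} [T(q_j x + β_j) - T(q_j x + γ_j)]`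
converges for a.e. `x ∈ 𝕋`, and its sum `ψ` satisfies
`‖ψ‖_p^p ≤ 2 Σ_{j≥1} j^(p+1) ‖β_j - γ_j‖`. -/
theorem statement3 (p : ℝ) (hp : 1 ≤ p) (q : ℕ → ℕ) (hq : ∀ j, 0 < q j)
    (β γ : ℕ → UnitAddCircle)
    (hsum : Summable (fun j : ℕ => ((j : ℝ) + 1) ^ (p + 1) * ‖β j - γ j‖)) :
    (∀ᵐ x ∂(volume : Measure UnitAddCircle),
      Summable (fun j : ℕ => ((haarT (q j • x + β j) : ℝ) - (haarT (q j • x + γ j) : ℝ)))) ∧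
    (∫ x, |(1 / 2 : ℝ) *
        ∑' j : ℕ, ((haarT (q j • x + β j) : ℝ) - (haarT (q j • x + γ j) : ℝ))| ^ p
        ∂(volume : Measure UnitAddCircle))
      ≤ 2 * ∑' j : ℕ, ((j : ℝ) + 1) ^ (p + 1) * ‖β j - γ j‖ := by
  choose B hBm hBv hB using fun j => exists_measurableSet_haarT_add_ne (β j) (γ j)
  let A (j : ℕ) : Set UnitAddCircle := (fun x => q j • x) ⁻¹' B j
  have hq' (j : ℕ) : MeasurePreserving (fun x : UnitAddCircle => q j • x) volume volume := by
    simpa using Measure.measurePreserving_zsmul (volume : Measure UnitAddCircle)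
      (n := (q j : ℤ)) (by exact_mod_cast (hq j).ne')
  have hAm (j : ℕ) : MeasurableSet (A j) := (hq' j).measurable (hBm j)
  have hAv (j : ℕ) : volume (A j) ≤ ENNReal.ofReal (2 * ‖β j - γ j‖) :=
    ((hq' j).measure_preimage (hBm j).nullMeasurableSet).trans_le (hBv j)
  have hzero {j : ℕ} {x : UnitAddCircle} (hx : x ∉ A j) :
      (haarT (q j • x + β j) : ℝ) - (haarT (q j • x + γ j) : ℝ) = 0 := by
    rw [sub_eq_zero, Int.cast_inj]
    exact not_not.mp fun h => hx (hB j _ h)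
  have hweight (j : ℕ) : ENNReal.ofReal (((j : ℝ) + 1) ^ (p + 1)) * volume (A j) ≤
      ENNReal.ofReal (2 * (((j : ℝ) + 1) ^ (p + 1) * ‖β j - γ j‖)) := by
    rw [mul_left_comm, ENNReal.ofReal_mul (by positivity)]
    gcongr
    exact hAv j
  have htotal : ∑' j : ℕ, ENNReal.ofReal (((j : ℝ) + 1) ^ (p + 1)) * volume (A j) ≤
      ENNReal.ofReal (2 * ∑' j : ℕ, ((j : ℝ) + 1) ^ (p + 1) * ‖β j - γ j‖) := by
    rw [← tsum_mul_left, ENNReal.ofReal_tsum_of_nonneg (fun j => by positivity)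
      (hsum.mul_left 2)]
    exact ENNReal.tsum_le_tsum hweight
  have hfin : ∀ᵐ x ∂(volume : Measure UnitAddCircle), {j | x ∈ A j}.Finite := by
    refine ae_finite_setOfPred_mem (ne_top_of_le_ne_top ENNReal.ofReal_ne_top
      (le_trans (ENNReal.tsum_le_tsum fun j => ?_) htotal))
    refine le_mul_of_one_le_left zero_le (ENNReal.one_le_ofReal.mpr ?_)
    exact Real.one_le_rpow (by simp) (by linarith)
  refine ⟨?_, ?_⟩
  · filter_upwards [hfin] with x hx
    refine summable_of_ne_finset_zero (s := hx.toFinset) fun j hj => hzero ?_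
    simpa using hj
  rw [← ENNReal.ofReal_le_ofReal_iff (by positivity)]
  refine le_trans ?_ htotal
  calc _ ≤ _ := Real.ofReal_le_enorm _
    _ ≤ _ := enorm_integral_le_lintegral_enorm _
    _ ≤ ∫⁻ x, ∑' j, (A j).indicator (fun _ => ENNReal.ofReal (((j : ℝ) + 1) ^ (p + 1))) x := by
      refine lintegral_mono_ae ?_
      filter_upwards [hfin] with x hx
      have hbound : |(1 / 2 : ℝ) *
          ∑' j : ℕ, ((haarT (q j • x + β j) : ℝ) - (haarT (q j • x + γ j) : ℝ))| ≤
          hx.toFinset.card := by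
        rw [tsum_eq_sum (s := hx.toFinset) fun j hj => hzero (by simpa using hj),
          Finset.mul_sum]
        refine (Finset.abs_sum_le_sum_abs _ _).trans ?_
        simpa using Finset.sum_le_card_nsmul hx.toFinset _ 1
          fun j _ => abs_half_mul_haarT_sub_le_one (q j • x + β j) (q j • x + γ j)
      rw [Real.enorm_eq_ofReal (by positivity)]
      calc _ ≤ ENNReal.ofReal (∑ j ∈ hx.toFinset, ((j : ℝ) + 1) ^ (p + 1)) :=
            ENNReal.ofReal_le_ofReal
              ((Real.rpow_le_rpow (abs_nonneg _) hbound (by linarith)).trans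
                (Finset.card_rpow_le_sum_rpow _ (by linarith)))
        _ = ∑ j ∈ hx.toFinset,
              (A j).indicator (fun _ => ENNReal.ofReal (((j : ℝ) + 1) ^ (p + 1))) x := by
            rw [ENNReal.ofReal_sum_of_nonneg fun j _ => by positivity]
            refine Finset.sum_congr rfl fun j hj => ?_
            rw [Set.indicator_of_mem (by simpa using hj)]
        _ ≤ _ := ENNReal.sum_le_tsum _
    _ = ∑' j : ℕ, ENNReal.ofReal (((j : ℝ) + 1) ^ (p + 1)) * volume (A j) := by
      rw [lintegral_tsum fun j => (measurable_const.indicator (hAm j)).aemeasurable]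
      simp_rw [lintegral_indicator_const (hAm _)]
end

section
/- Let p ≥ 1, let α, α′ ∈ ℝ, let n be a positive integer and let q_1, …, q_n be positive integers. Then the function ψ(x) = (1/2)·Σ_{j=1}^{n} [T(q_j(x + α)) − T(q_j(x + α′))] satisfies ‖ψ‖_p^p ≤ 2·|α − α′|·Σ_{j=1}^{n} j^{p+1}·q_j. -/
open MeasureTheory

theorem haarT_coe (t : ℝ) : haarT (t : UnitAddCircle) = if Even ⌊2 * t⌋ then 1 else -1 := by
  have hcoe : ((AddCircle.equivIco 1 0 (t : UnitAddCircle)) : ℝ) = Int.fract t := by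
    simp
  have hsplit := Int.floor_add_fract t
  have h0 := Int.fract_nonneg t
  have h1 := Int.fract_lt_one t
  rw [haarT, hcoe]
  by_cases h : Int.fract t < 1 / 2
  · have hf : ⌊2 * t⌋ = 2 * ⌊t⌋ := by
      rw [Int.floor_eq_iff]; push_cast; constructor <;> linarith
    simp only [h, hf, even_two_mul, if_true]
  · have hf : ⌊2 * t⌋ = 2 * ⌊t⌋ + 1 := by
      rw [Int.floor_eq_iff]; push_cast; constructor <;> linarith
    have hodd : ¬ Even (2 * ⌊t⌋ + 1) := by simp
    simp only [h, hf, hodd, if_false]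

theorem haarT_eq_one_or (x : UnitAddCircle) : haarT x = 1 ∨ haarT x = -1 := by
  unfold haarT; split_ifs <;> simp

/-- The two arcs of length `|β|` containing every point at which `haarT` changes value under
translation by `β`. -/
def haarJumpArcs (β : ℝ) : Set UnitAddCircle :=
  Metric.closedBall ((-(β / 2) : ℝ) : UnitAddCircle) (|β| / 2) ∪
    Metric.closedBall ((1 / 2 - β / 2 : ℝ) : UnitAddCircle) (|β| / 2)

theorem measurableSet_haarJumpArcs (β : ℝ) : MeasurableSet (haarJumpArcs β) :=
  Metric.isClosed_closedBall.measurableSet.union Metric.isClosed_closedBall.measurableSet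

theorem volume_haarJumpArcs_le (β : ℝ) : volume.real (haarJumpArcs β) ≤ 2 * |β| := by
  have hball : ∀ c : UnitAddCircle, volume.real (Metric.closedBall c (|β| / 2)) ≤ |β| := by
    intro c
    rw [Measure.real, AddCircle.volume_closedBall]
    refine ENNReal.toReal_le_of_le_ofReal (abs_nonneg β) (ENNReal.ofReal_le_ofReal ?_)
    exact (min_le_right _ _).trans (by linarith)
  calc volume.real (haarJumpArcs β) ≤ _ := measureReal_union_le _ _
    _ ≤ |β| + |β| := add_le_add (hball _) (hball _)
    _ = 2 * |β| := by ring

theorem coe_mem_closedBall {t c r : ℝ} (k : ℤ) (h : |t - c - k| ≤ r) :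
    (t : UnitAddCircle) ∈ Metric.closedBall (c : UnitAddCircle) r := by
  have hk : ((k : ℝ) : UnitAddCircle) = 0 := by
    rw [AddCircle.coe_eq_zero_iff]; exact ⟨k, by simp⟩
  have hc : (t : UnitAddCircle) - (c : UnitAddCircle) = ((t - c - k : ℝ) : UnitAddCircle) := by
    rw [AddCircle.coe_sub, AddCircle.coe_sub, hk, sub_zero]
  rw [mem_closedBall_iff_norm, hc]
  exact (QuotientAddGroup.norm_mk_le_norm).trans h

theorem mem_haarJumpArcs_of_haarT_ne {β : ℝ} {y : UnitAddCircle}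
    (h : haarT (y + (β : UnitAddCircle)) ≠ haarT y) : y ∈ haarJumpArcs β := by
  obtain ⟨t, rfl⟩ := QuotientAddGroup.mk_surjective y
  change haarT ((t : UnitAddCircle) + β) ≠ haarT (t : UnitAddCircle) at h
  change (t : UnitAddCircle) ∈ haarJumpArcs β
  rw [← AddCircle.coe_add, haarT_coe, haarT_coe] at h
  have hne : ⌊2 * (t + β)⌋ ≠ ⌊2 * t⌋ := fun he => h (by rw [he])
  obtain ⟨m, hm⟩ : ∃ m : ℤ, |t + β / 2 - m / 2| ≤ |β| / 2 := by
    rcases hne.lt_or_gt with hlt | hlt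
    · refine ⟨⌊2 * t⌋, ?_⟩
      have h1 := Int.floor_lt.1 hlt
      have h2 := Int.floor_le (2 * t)
      rw [abs_of_neg (by linarith : β < 0), abs_le]
      constructor <;> linarith
    · refine ⟨⌊2 * (t + β)⌋, ?_⟩
      have h1 := Int.floor_lt.1 hlt
      have h2 := Int.floor_le (2 * (t + β))
      rw [abs_of_pos (by linarith : 0 < β), abs_le]
      constructor <;> linarith
  rcases Int.even_or_odd' m with ⟨k, rfl | rfl⟩
  · refine Or.inl (coe_mem_closedBall k ?_)
    convert hm using 2
    push_cast; ring
  · refine Or.inr (coe_mem_closedBall k ?_)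
    convert hm using 2
    push_cast; ring

theorem abs_haarT_sub_le (β : ℝ) (y : UnitAddCircle) :
    |(haarT (y + (β : UnitAddCircle)) : ℝ) - haarT y| ≤ 2 * (haarJumpArcs β).indicator 1 y := by
  by_cases h : haarT (y + (β : UnitAddCircle)) = haarT y
  · rw [h, sub_self, abs_zero]
    exact mul_nonneg zero_le_two (Set.indicator_nonneg (fun _ _ => zero_le_one) _)
  · rw [Set.indicator_of_mem (mem_haarJumpArcs_of_haarT_ne h)]
    rcases haarT_eq_one_or (y + (β : UnitAddCircle)) with h1 | h1 <;>
      rcases haarT_eq_one_or y with h2 | h2 <;> rw [h1, h2] <;> norm_num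

theorem measurePreserving_nsmul_add {k : ℕ} (hk : 0 < k) (a : UnitAddCircle) :
    MeasurePreserving (fun x : UnitAddCircle => k • (x + a)) := by
  have h := Measure.measurePreserving_zsmul (volume : Measure UnitAddCircle)
    (Int.natCast_ne_zero.2 hk.ne')
  simp only [natCast_zsmul] at h
  exact h.comp (measurePreserving_add_right volume a)

theorem sum_zero_one_le (a : ℕ → ℝ) (ha : ∀ j, a j = 0 ∨ a j = 1) (n : ℕ) :
    ∑ j ∈ Finset.range n, a j ≤ n := by
  refine (Finset.sum_le_card_nsmul _ _ 1 fun j _ => ?_).trans (by simp)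
  rcases ha j with h | h <;> simp [h]

theorem sum_zero_one_rpow_le {p : ℝ} (hp : 0 < p) (a : ℕ → ℝ) (ha : ∀ j, a j = 0 ∨ a j = 1)
    (n : ℕ) :
    (∑ j ∈ Finset.range n, a j) ^ p ≤ ∑ j ∈ Finset.range n, ((j : ℝ) + 1) ^ (p + 1) * a j := by
  have ha0 : ∀ j, 0 ≤ a j := fun j => by rcases ha j with h | h <;> simp [h]
  induction n with
  | zero => simp [Real.zero_rpow hp.ne']
  | succ n ih =>
    rcases ha n with h | h
    · simpa only [Finset.sum_range_succ, h, mul_zero, add_zero] using ih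
    · have hS := sum_zero_one_le a ha (n + 1)
      push_cast at hS
      have hn : (0 : ℝ) ≤ n := n.cast_nonneg
      calc (∑ j ∈ Finset.range (n + 1), a j) ^ p ≤ ((n : ℝ) + 1) ^ p :=
            Real.rpow_le_rpow (Finset.sum_nonneg fun j _ => ha0 j) hS hp.le
        _ ≤ ((n : ℝ) + 1) ^ (p + 1) :=
            Real.rpow_le_rpow_of_exponent_le (by linarith) (by linarith)
        _ = ((n : ℝ) + 1) ^ (p + 1) * a n := by rw [h, mul_one]
        _ ≤ ∑ j ∈ Finset.range (n + 1), ((j : ℝ) + 1) ^ (p + 1) * a j :=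
            Finset.single_le_sum (f := fun j : ℕ => ((j : ℝ) + 1) ^ (p + 1) * a j)
              (fun j _ => mul_nonneg (Real.rpow_nonneg (by positivity) _) (ha0 j))
              (Finset.self_mem_range_succ n)

/-- for `p ≥ 1`, reals `α, α'`, and positive integers `q_1, …, q_n` (here `q j`
for `j < n` stands for the paper's `q_{j+1}`), the function
`ψ(x) = (1/2) Σ_{j=1}^n [T(q_j(x+α)) - T(q_j(x+α'))]` satisfies
`‖ψ‖_p^p ≤ 2 |α - α'| Σ_{j=1}^n j^(p+1) q_j`. -/
theorem statement5 (p : ℝ) (hp : 1 ≤ p) (α α' : ℝ) (n : ℕ) (hn : 0 < n)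
    (q : ℕ → ℕ) (hq : ∀ j, 0 < q j) :
    (∫ x, |(1 / 2 : ℝ) * ∑ j ∈ Finset.range n,
          ((haarT (q j • (x + (α : UnitAddCircle))) : ℝ)
            - (haarT (q j • (x + (α' : UnitAddCircle))) : ℝ))| ^ p
        ∂(volume : Measure UnitAddCircle))
      ≤ 2 * |α - α'| * ∑ j ∈ Finset.range n, ((j : ℝ) + 1) ^ (p + 1) * (q j : ℝ) := by
  have hp0 : 0 < p := zero_lt_one.trans_le hp
  set β : ℕ → ℝ := fun j => q j * (α - α')
  set φ : ℕ → UnitAddCircle → UnitAddCircle := fun j x => q j • (x + (α' : UnitAddCircle))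
  set E : ℕ → Set UnitAddCircle := fun j => φ j ⁻¹' haarJumpArcs (β j)
  have hφ : ∀ j, MeasurePreserving (φ j) := fun j => measurePreserving_nsmul_add (hq j) _
  have hE : ∀ j, MeasurableSet (E j) := fun j =>
    (hφ j).measurable (measurableSet_haarJumpArcs _)
  have hvol : ∀ j, volume.real (E j) ≤ 2 * |α - α'| * q j := fun j => by
    rw [Measure.real, (hφ j).measure_preimage (measurableSet_haarJumpArcs _).nullMeasurableSet]
    refine (volume_haarJumpArcs_le _).trans_eq ?_
    rw [abs_mul, Nat.abs_cast]; ring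
  have hshift : ∀ j (x : UnitAddCircle),
      q j • (x + (α : UnitAddCircle)) = φ j x + ((β j : ℝ) : UnitAddCircle) := fun j x => by
    have hβ : ((β j : ℝ) : UnitAddCircle) = q j • ((α : UnitAddCircle) - α') := by
      rw [← AddCircle.coe_sub, ← AddCircle.coe_nsmul, nsmul_eq_mul]
    rw [hβ, ← smul_add]; congr 1; abel
  have hpt : ∀ x : UnitAddCircle, |(1 / 2 : ℝ) * ∑ j ∈ Finset.range n,
      ((haarT (q j • (x + (α : UnitAddCircle))) : ℝ)
        - (haarT (q j • (x + (α' : UnitAddCircle))) : ℝ))| ^ p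
      ≤ ∑ j ∈ Finset.range n, ((j : ℝ) + 1) ^ (p + 1) * (E j).indicator 1 x := fun x => by
    refine le_trans (Real.rpow_le_rpow (abs_nonneg _) ?_ hp0.le)
      (sum_zero_one_rpow_le hp0 (fun j => (E j).indicator 1 x)
        (fun j => Set.indicator_eq_zero_or_self (E j) 1 x) n)
    rw [abs_mul, abs_of_pos one_half_pos, one_div, inv_mul_le_iff₀ two_pos, Finset.mul_sum]
    refine (Finset.abs_sum_le_sum_abs _ _).trans (Finset.sum_le_sum fun j _ => ?_)
    rw [hshift]
    exact abs_haarT_sub_le (β j) (φ j x)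
  have hint : ∀ j ∈ Finset.range n, Integrable
      (fun x => ((j : ℝ) + 1) ^ (p + 1) * (E j).indicator (1 : UnitAddCircle → ℝ) x) := fun j _ =>
    ((integrable_const (1 : ℝ)).indicator (hE j)).const_mul _
  calc _ ≤ ∫ x : UnitAddCircle,
        ∑ j ∈ Finset.range n, ((j : ℝ) + 1) ^ (p + 1) * (E j).indicator 1 x :=
        integral_mono_of_nonneg
          (Filter.Eventually.of_forall fun x => Real.rpow_nonneg (abs_nonneg _) _)
          (integrable_finsetSum _ hint) (Filter.Eventually.of_forall hpt)
    _ = ∑ j ∈ Finset.range n, ((j : ℝ) + 1) ^ (p + 1) * volume.real (E j) := by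
        rw [integral_finsetSum _ hint]
        refine Finset.sum_congr rfl fun j _ => ?_
        rw [integral_const_mul, integral_indicator_one (hE j)]
    _ ≤ ∑ j ∈ Finset.range n, ((j : ℝ) + 1) ^ (p + 1) * (2 * |α - α'| * q j) :=
        Finset.sum_le_sum fun j _ => mul_le_mul_of_nonneg_left (hvol j)
          (Real.rpow_nonneg (by positivity) _)
    _ = _ := by
        rw [Finset.mul_sum]
        exact Finset.sum_congr rfl fun j _ => by ring
end

section
/- Let n be a positive integer and for j = 1, …, n let ψ_j : ℝ → ℝ be a periodic function with positive integer period u_j, such that: (a) u_n is even and u_j is a multiple of 2u_{j+1} for j = 1, …, n−1; and (b) for each j there is an irrational z_j ∈ ℝ with ψ_j ≡ 1 on [z_j, z_j + u_j/2) and ψ_j ≡ −1 on [z_j + u_j/2, z_j + u_j). Let R ⊂ ℤ be a complete residue system modulo u_1 (a set of u_1 integers whose residues modulo u_1 are pairwise distinct). Then for every sequence (s_1, …, s_n) ∈ {−1, 1}^n, the cardinality of {k ∈ R : ψ_j(k) = s_j for j = 1, …, n} equals u_1 / 2^n. -/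
open Classical in
/-- If `P j` is negated by translation by `h j`, while every later `P i` is invariant under it,
then all `2 ^ n` truth patterns of `P 0, …, P (n - 1)` are equidistributed. -/
lemma card_filter_forall_mul_two_pow {G : Type*} [AddGroup G] [Fintype G] (n : ℕ)
    (P : ℕ → G → Prop) (h : ℕ → G)
    (hflip : ∀ j < n, ∀ a, P j (a + h j) ↔ ¬ P j a)
    (hinv : ∀ i < n, ∀ j < i, ∀ a, P i (a + h j) ↔ P i a) :
    (Finset.univ.filter fun a => ∀ j < n, P j a).card * 2 ^ n = Fintype.card G := by
  induction n generalizing P h with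
  | zero => simp
  | succ n ih =>
    have htail := ih (fun j => P (j + 1)) (fun j => h (j + 1))
      (fun j hj => hflip (j + 1) (by omega))
      (fun i hi j hj => hinv (i + 1) (by omega) (j + 1) (by omega))
    set A := Finset.univ.filter fun a => ∀ j < n, P (j + 1) a with hA
    have hhead : (Finset.univ.filter fun a => ∀ j < n + 1, P j a) = A.filter (P 0) := by
      ext a
      simp only [hA, Finset.mem_filter, Finset.mem_univ, true_and, Nat.forall_lt_succ_left]
      tauto
    have hswap : (A.filter (P 0)).card = (A.filter fun a => ¬ P 0 a).card := by
      refine Finset.card_equiv (Equiv.addRight (h 0)) fun a => ?_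
      have hA0 : (∀ j < n, P (j + 1) (a + h 0)) ↔ ∀ j < n, P (j + 1) a :=
        forall₂_congr fun j hj => hinv (j + 1) (by omega) 0 (by omega) a
      simp only [hA, Finset.mem_filter, Finset.mem_univ, true_and, Equiv.coe_addRight, hA0,
        hflip 0 (by omega) a, not_not]
    have hsplit := Finset.card_filter_add_card_filter_not (s := A) (P 0)
    rw [hhead, ← htail, ← hsplit, ← hswap]
    ring

/-- A square wave changes sign under translation by half a period. -/
lemma eq_neg_of_add_half_period {f : ℝ → ℝ} {u z : ℝ} (hu : 0 < u)
    (hper : Function.Periodic f u)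
    (hpos : ∀ x ∈ Set.Ico z (z + u / 2), f x = 1)
    (hneg : ∀ x ∈ Set.Ico (z + u / 2) (z + u), f x = -1) (x : ℝ) :
    (f x = 1 ∨ f x = -1) ∧ f (x + u / 2) = -f x := by
  obtain ⟨m, ⟨h₁, h₂⟩, -⟩ := existsUnique_add_zsmul_mem_Ico hu x z
  have hm (y : ℝ) : f (y + m • u) = f y := hper.zsmul m y
  rw [← hm x, ← hm (x + u / 2), add_right_comm]
  generalize x + m • u = y at h₁ h₂
  rcases lt_or_ge y (z + u / 2) with hy | hy
  · rw [hpos y ⟨h₁, hy⟩, hneg (y + u / 2) ⟨by linarith, by linarith⟩]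
    simp
  · have hback : f (y + u / 2) = f (y - u / 2) := by
      rw [← hper (y - u / 2)]
      congr 1
      ring
    rw [hback, hneg y ⟨hy, h₂⟩, hpos (y - u / 2) ⟨by linarith, by linarith⟩]
    simp

/-- A complete residue system has as many elements satisfying `p` as there are residues
satisfying it. -/
lemma ncard_residueSystem {N : ℕ} [NeZero N] (R : Finset ℤ) (hcard : R.card = N)
    (hres : Set.InjOn (fun k : ℤ => (k : ZMod N)) (R : Set ℤ)) (p : ZMod N → Prop) :
    {k ∈ (R : Set ℤ) | p (k : ZMod N)}.ncard = {a | p a}.ncard := by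
  rw [← (hres.mono fun k hk => hk.1).ncard_image]
  congr 1
  ext a
  have himage : R.image (fun k : ℤ => (k : ZMod N)) = Finset.univ := by
    rw [← Finset.card_eq_iff_eq_univ, Finset.card_image_of_injOn hres, hcard, ZMod.card]
  obtain ⟨k, hk, rfl⟩ := Finset.mem_image.1 (himage ▸ Finset.mem_univ a)
  constructor
  · rintro ⟨l, hl, hlk⟩
    have hlk' : (l : ZMod N) = k := hlk
    simpa [← hlk'] using hl.2
  · exact fun ha => ⟨k, ⟨hk, ha⟩, rfl⟩


/-- let `ψ_1, …, ψ_n : ℝ → ℝ` (here `ψ j`, `j < n`, stands for the paper's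
`ψ_{j+1}`) be periodic with positive integer periods `u_1, …, u_n` such that `u_n` is even,
`u_j` is a multiple of `2u_{j+1}`, and each `ψ_j` is `1` on `[z_j, z_j + u_j/2)` and `-1` on
`[z_j + u_j/2, z_j + u_j)` for some irrational `z_j`. If `R` is a complete residue system
modulo `u_1`, then for each `(s_1, …, s_n) ∈ {-1,1}^n` the set
`{k ∈ R : ψ_j(k) = s_j, j = 1, …, n}` has exactly `u_1 / 2^n` elements. -/
theorem statement7 (n : ℕ) (hn : 0 < n) (u : ℕ → ℕ) (ψ : ℕ → ℝ → ℝ)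
    (hu : ∀ j < n, 0 < u j)
    (hper : ∀ j < n, ∀ z : ℝ, ψ j (z + (u j : ℝ)) = ψ j z)
    (heven : Even (u (n - 1)))
    (hdvd : ∀ j : ℕ, j + 1 < n → 2 * u (j + 1) ∣ u j)
    (hplateau : ∀ j < n, ∃ z : ℝ, Irrational z ∧
      (∀ x ∈ Set.Ico z (z + (u j : ℝ) / 2), ψ j x = 1) ∧
      (∀ x ∈ Set.Ico (z + (u j : ℝ) / 2) (z + (u j : ℝ)), ψ j x = -1))
    (R : Finset ℤ) (hcard : R.card = u 0)
    (hres : Set.InjOn (fun k : ℤ => (k : ZMod (u 0))) (R : Set ℤ)) :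
    ∀ s : ℕ → ℝ, (∀ j < n, s j = 1 ∨ s j = -1) →
      {k ∈ (R : Set ℤ) | ∀ j < n, ψ j (k : ℝ) = s j}.ncard * 2 ^ n = u 0 := by
  intro s hs
  have : NeZero (u 0) := ⟨(hu 0 hn).ne'⟩
  have hchain : ∀ i < n, ∀ j ≤ i, u i ∣ u j := by
    intro i hi j hji
    induction i, hji using Nat.le_induction with
    | base => exact dvd_rfl
    | succ i _ ih =>
      exact ((Dvd.intro_left 2 rfl).trans (hdvd i hi)).trans (ih (by omega))
  have hhalf : ∀ i < n, ∀ j < i, u i ∣ u j / 2 := fun i hi j hji =>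
    (hchain i hi (j + 1) hji).trans <|
      Nat.dvd_div_of_mul_dvd (hdvd j (by omega))
  have htwo : ∀ j < n, ((u j / 2 : ℕ) : ℝ) = (u j : ℝ) / 2 := by
    intro j hj
    have : 2 ∣ u j := heven.two_dvd.trans (hchain (n - 1) (by omega) j (by omega))
    simpa using Nat.cast_div_charZero (K := ℝ) this
  have hshift : ∀ j < n, ∀ m : ℤ, (u j : ℤ) ∣ m → ∀ x : ℝ, ψ j (x + m) = ψ j x := by
    rintro j hj _ ⟨c, rfl⟩ x
    have hp : Function.Periodic (ψ j) (u j) := hper j hj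
    simpa [mul_comm] using hp.int_mul c x
  have hwave : ∀ j < n, ∀ x : ℝ, (ψ j x = 1 ∨ ψ j x = -1) ∧
      ψ j (x + (u j / 2 : ℕ)) = -ψ j x := by
    intro j hj x
    obtain ⟨z, -, hpos, hneg⟩ := hplateau j hj
    rw [htwo j hj]
    exact eq_neg_of_add_half_period (by exact_mod_cast hu j hj) (hper j hj) hpos hneg x
  let g : ℕ → ZMod (u 0) → ℝ := fun j a => ψ j ((a.cast : ℤ) : ℝ)
  have hg : ∀ j < n, ∀ k : ℤ, g j (k : ZMod (u 0)) = ψ j k := by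
    intro j hj k
    have hdiv : (u j : ℤ) ∣ (u 0 : ℤ) * (k / u 0) :=
      (Int.natCast_dvd_natCast.2 (hchain j hj 0 (by omega))).mul_right _
    simp only [g, ZMod.coe_intCast]
    rw [← hshift j hj _ hdiv, ← Int.cast_add, Int.emod_add_mul_ediv]
  have hadd (j : ℕ) (k : ℤ) : (k : ZMod (u 0)) + ((u j / 2 : ℕ) : ZMod (u 0)) =
      ((k + (u j / 2 : ℕ) : ℤ) : ZMod (u 0)) := by
    rw [Int.cast_add, Int.cast_natCast]
  have hset : {k ∈ (R : Set ℤ) | ∀ j < n, ψ j (k : ℝ) = s j} =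
      {k ∈ (R : Set ℤ) | ∀ j < n, g j (k : ZMod (u 0)) = s j} := by
    ext k
    exact and_congr_right fun _ => forall₂_congr fun j hj => by rw [hg j hj]
  classical
  rw [hset, ncard_residueSystem R hcard hres fun a => ∀ j < n, g j a = s j,
    Set.ncard_eq_toFinset_card', Set.toFinset_ofPred]
  have hcount := card_filter_forall_mul_two_pow n (fun j a => g j a = s j)
    (fun j => ((u j / 2 : ℕ) : ZMod (u 0))) ?_ ?_
  · rw [ZMod.card] at hcount
    convert hcount
  · intro j hj a
    obtain ⟨k, rfl⟩ := ZMod.intCast_surjective a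
    obtain ⟨hval, hneg⟩ := hwave j hj k
    have hcast : ((k + (u j / 2 : ℕ) : ℤ) : ℝ) = k + (u j / 2 : ℕ) := by
      rw [Int.cast_add, Int.cast_natCast]
    simp only [hadd j k, hg j hj, hcast, hneg]
    rcases hval with h | h <;> rcases hs j hj with h' | h' <;> rw [h, h'] <;> norm_num
  · intro i hi j hji a
    obtain ⟨k, rfl⟩ := ZMod.intCast_surjective a
    simp only [hadd j k, hg i hi]
    rw [Int.cast_add, hshift i hi _ (Int.natCast_dvd_natCast.2 (hhalf i hi j hji))]
end

section
/- Let ψ : ℝ → ℝ be a periodic function with even positive integer period u such that there is an irrational z ∈ ℝ with ψ ≡ 1 on [z, z + u/2) and ψ ≡ −1 on [z + u/2, z + u). Let R ⊂ ℤ be a complete residue system modulo u. Then #{k ∈ R : ψ(k) = 1} = #{k ∈ R : ψ(k) = −1} = u/2. -/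
/-- A complete residue system modulo `u` is mapped bijectively by reduction modulo `u` onto any
integer interval of length `u`. -/
theorem image_toIcoMod_eq_Ico {u : ℕ} (hu : (0 : ℤ) < u) (R : Finset ℤ) (hcard : R.card = u)
    (hres : Set.InjOn (fun k : ℤ => (k : ZMod u)) (R : Set ℤ)) (a : ℤ) :
    Set.InjOn (toIcoMod hu a) (R : Set ℤ) ∧
      R.image (toIcoMod hu a) = Finset.Ico a (a + u) := by
  have hcast (k : ℤ) : ((toIcoMod hu a k : ℤ) : ZMod u) = k := by
    rw [toIcoMod]
    simp
  have hinj : Set.InjOn (toIcoMod hu a) (R : Set ℤ) := fun k hk l hl h =>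
    hres hk hl <| by
      simp only
      rw [← hcast k, ← hcast l, h]
  refine ⟨hinj, Finset.eq_of_subset_of_card_le ?_ ?_⟩
  · intro x hx
    obtain ⟨k, -, rfl⟩ := Finset.mem_image.1 hx
    exact Finset.mem_Ico.2 (toIcoMod_mem_Ico hu a k)
  · rw [Finset.card_image_of_injOn hinj, hcard, Int.card_Ico]
    omega

/-- A `u`-periodic function on `ℤ` takes each value equally often on a complete residue system
modulo `u` and on an integer interval of length `u`. -/
theorem card_filter_eq_card_filter_Ico {α : Type*} [DecidableEq α] {f : ℤ → α} {u : ℕ}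
    (hu : (0 : ℤ) < u) (hf : Function.Periodic f (u : ℤ)) (R : Finset ℤ) (hcard : R.card = u)
    (hres : Set.InjOn (fun k : ℤ => (k : ZMod u)) (R : Set ℤ)) (a : ℤ) (v : α) :
    (R.filter fun k => f k = v).card = ((Finset.Ico a (a + u)).filter fun k => f k = v).card := by
  obtain ⟨hinj, himage⟩ := image_toIcoMod_eq_Ico hu R hcard hres a
  have hf' (k : ℤ) : f (toIcoMod hu a k) = f k := hf.sub_zsmul_eq _
  rw [← himage, Finset.filter_image, Finset.card_image_of_injOn
    (hinj.mono (Finset.coe_subset.2 (Finset.filter_subset _ _)))]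
  simp only [hf']

/-- let `ψ : ℝ → ℝ` be periodic with even positive integer period `u`, equal to
`1` on `[z, z + u/2)` and `-1` on `[z + u/2, z + u)` for some irrational `z`. If `R` is a
complete residue system modulo `u`, then `#{k ∈ R : ψ(k) = 1} = #{k ∈ R : ψ(k) = -1} = u/2`. -/
theorem statement8 (ψ : ℝ → ℝ) (u : ℕ) (hu : 0 < u) (heven : Even u)
    (hper : ∀ z : ℝ, ψ (z + (u : ℝ)) = ψ z)
    (z : ℝ) (hz : Irrational z)
    (h1 : ∀ x ∈ Set.Ico z (z + (u : ℝ) / 2), ψ x = 1)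
    (h2 : ∀ x ∈ Set.Ico (z + (u : ℝ) / 2) (z + (u : ℝ)), ψ x = -1)
    (R : Finset ℤ) (hcard : R.card = u)
    (hres : Set.InjOn (fun k : ℤ => (k : ZMod u)) (R : Set ℤ)) :
    {k ∈ (R : Set ℤ) | ψ (k : ℝ) = 1}.ncard * 2 = u ∧
    {k ∈ (R : Set ℤ) | ψ (k : ℝ) = -1}.ncard * 2 = u := by
  classical
  obtain ⟨m, rfl⟩ := heven
  have hu' : (0 : ℤ) < (m + m : ℕ) := by exact_mod_cast hu
  have hhalf : ((m + m : ℕ) : ℝ) / 2 = m := by push_cast; ring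
  rw [hhalf] at h1 h2
  have hf : Function.Periodic (fun k : ℤ => ψ k) ((m + m : ℕ) : ℤ) := fun k => by
    simpa using hper k
  have hone (k : ℤ) (hk : k ∈ Finset.Ico ⌈z⌉ (⌈z⌉ + m)) : ψ k = 1 := by
    obtain ⟨hl, hr⟩ := Finset.mem_Ico.1 hk
    refine h1 _ ⟨Int.ceil_le.1 hl, ?_⟩
    have := Int.lt_ceil.1 (show k - m < ⌈z⌉ by omega)
    push_cast at this
    linarith
  have hneg (k : ℤ) (hk : k ∈ Finset.Ico (⌈z⌉ + m) (⌈z⌉ + (m + m : ℕ))) : ψ k = -1 := by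
    obtain ⟨hl, hr⟩ := Finset.mem_Ico.1 hk
    have hl' := Int.ceil_le.1 (show ⌈z⌉ ≤ k - m by omega)
    have hr' := Int.lt_ceil.1 (show k - (m + m : ℕ) < ⌈z⌉ by omega)
    push_cast at hl' hr'
    refine h2 _ ⟨by linarith, by push_cast; linarith⟩
  have hcount (v : ℝ) : {k ∈ (R : Set ℤ) | ψ (k : ℝ) = v}.ncard =
      ((Finset.Ico ⌈z⌉ (⌈z⌉ + (m + m : ℕ))).filter fun k : ℤ => ψ k = v).card := by
    rw [← card_filter_eq_card_filter_Ico hu' hf R hcard hres ⌈z⌉ v, ← Set.ncard_coe_finset]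
    simp
  have hsplit : Finset.Ico ⌈z⌉ (⌈z⌉ + (m + m : ℕ)) =
      Finset.Ico ⌈z⌉ (⌈z⌉ + m) ∪ Finset.Ico (⌈z⌉ + m) (⌈z⌉ + (m + m : ℕ)) :=
    (Finset.Ico_union_Ico_eq_Ico (by omega) (by omega)).symm
  rw [hcount, hcount, hsplit, Finset.filter_union, Finset.filter_union,
    Finset.filter_true_of_mem hone, Finset.filter_true_of_mem hneg,
    Finset.filter_false_of_mem fun k hk => by rw [hneg k hk]; norm_num,
    Finset.filter_false_of_mem fun k hk => by rw [hone k hk]; norm_num,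
    Finset.union_empty, Finset.empty_union, Int.card_Ico, Int.card_Ico]
  omega
end

section
/- For Lebesgue-almost every α ∈ ℝ, α is irrational and there exists a strictly increasing sequence of indices (n_j) such that the continuants (q_{n_j}) of the continued fraction expansion of α satisfy: 2q_{n_j} divides q_{n_{j+1}} for every j, and lim_{j→∞} q_{n_j}·‖q_{n_j}α‖ = 0. -/
open MeasureTheory Filter

lemma exists_rat_abs_sub_le_one_div_den_sq_of_irrational {α : ℝ} (hα : Irrational α) (N : ℕ) :
    ∃ r : ℚ, N < r.den ∧ |α - r| ≤ 1 / (r.den : ℝ) ^ 2 := by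
  have hev := (tendsto_one_div_atTop_nhds_zero_nat (𝕜 := ℝ)).eventually
    (hα.eventually_forall_le_dist_cast_rat_of_den_le N)
  obtain ⟨n, hn, hn0⟩ := (hev.and (eventually_gt_atTop 0)).exists
  obtain ⟨r, hr, hrn⟩ := Real.exists_rat_abs_sub_le_and_den_le α hn0
  have hd : (1 : ℝ) ≤ r.den := by exact_mod_cast r.pos
  have hdn : (r.den : ℝ) ≤ n := by exact_mod_cast hrn
  refine ⟨r, ?_, hr.trans ?_⟩
  · by_contra! h
    have h1 := hn r h
    rw [Real.dist_eq] at h1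
    have h2 : 1 / (((n : ℝ) + 1) * r.den) < 1 / (n : ℝ) := by
      apply one_div_lt_one_div_of_lt
      · exact_mod_cast hn0
      · nlinarith
    linarith
  · apply one_div_le_one_div_of_le
    · positivity
    · nlinarith

/-- Given a matrix of determinant one, some combination of its columns with coprime
coefficients in `[0, m]` has second entry divisible by `m`. -/
lemma exists_coprime_combination_dvd {m : ℤ} (hm : 0 < m) {p q p' q' : ℤ}
    (hdet : p * q' - p' * q = 1) :
    ∃ a b : ℤ, 1 ≤ a ∧ a ≤ m ∧ 0 ≤ b ∧ b ≤ m ∧ m ∣ a * q + b * q' ∧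
      IsCoprime (a * p + b * p') (a * q + b * q') := by
  have hlt := Int.emod_lt_of_pos q' hm
  have hnn := Int.emod_nonneg q' hm.ne'
  have hlt' := Int.emod_lt_of_pos q hm
  have hnn' := Int.emod_nonneg q hm.ne'
  have e := Int.emod_add_mul_ediv q' m
  have e' := Int.emod_add_mul_ediv q m
  set s := q' % m
  set t := q % m
  have hgpos : 0 < Int.gcd (m - s) t := Int.gcd_pos_of_ne_zero_left _ (by omega)
  obtain ⟨a, b, hab, ha, hb⟩ := Int.exists_gcd_one hgpos
  set d : ℤ := (Int.gcd (m - s) t : ℤ)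
  have hd : 1 ≤ d := Int.natCast_pos.mpr hgpos
  have hdm : IsCoprime m d := by
    refine ⟨p * (q' / m) - p' * (q / m) + p, -(p * a) - p' * b, ?_⟩
    linear_combination p * ha + p' * hb + hdet + p * e - p' * e'
  have ha1 : 1 ≤ a := by
    by_contra! h
    nlinarith
  have hb0 : 0 ≤ b := by
    by_contra! h
    nlinarith
  refine ⟨a, b, ha1, by nlinarith, hb0, by nlinarith, ?_, ?_⟩
  · refine hdm.dvd_of_dvd_mul_right ⟨q + t * (q' / m) - s * (q / m), ?_⟩
    linear_combination -q * ha - q' * hb - t * e + s * e'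
  · obtain ⟨u, v, huv⟩ := Int.isCoprime_iff_gcd_eq_one.mpr hab
    refine ⟨u * q' - v * q, v * p - u * p', ?_⟩
    linear_combination huv + (u * a + v * b) * hdet

lemma exists_det_eq_one {p q : ℤ} (hq : 0 < q) (h : IsCoprime p q) :
    ∃ p' q' : ℤ, 0 ≤ q' ∧ q' < q ∧ p * q' - p' * q = 1 := by
  obtain ⟨u, v, huv⟩ := h
  refine ⟨-(v + p * (u / q)), u % q, Int.emod_nonneg u hq.ne', Int.emod_lt_of_pos u hq, ?_⟩
  linear_combination huv + p * Int.emod_add_mul_ediv u q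

/-- Every irrational number has infinitely many reduced rational approximations of quadratic
quality whose denominators are divisible by `m`. -/
lemma exists_rat_dvd_den_abs_sub_lt_of_irrational {α : ℝ} (hα : Irrational α) {m : ℕ}
    (hm : 0 < m) (N : ℕ) :
    ∃ r : ℚ, N ≤ r.den ∧ m ∣ r.den ∧ |α - r| < 7 * (m : ℝ) ^ 2 / (r.den : ℝ) ^ 2 := by
  obtain ⟨r, hN, hr⟩ := exists_rat_abs_sub_le_one_div_den_sq_of_irrational hα N
  obtain ⟨p', q', hq'0, hq', hdet⟩ := exists_det_eq_one (p := r.num) (q := (r.den : ℤ))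
    (by exact_mod_cast r.pos) (Int.isCoprime_iff_gcd_eq_one.mpr r.reduced)
  obtain ⟨a, b, ha1, ham, hb0, hbm, hdvd, hcop⟩ :=
    exists_coprime_combination_dvd (m := m) (by exact_mod_cast hm) hdet
  set p := r.num with hp
  set q : ℤ := (r.den : ℤ) with hq
  have hqpos : 0 < q := by rw [hq]; exact_mod_cast r.pos
  set P := a * p + b * p' with hP
  set Q := a * q + b * q' with hQ
  have hqQ : q ≤ Q := by nlinarith [mul_nonneg hb0 hq'0]
  have hQle : Q ≤ 2 * m * q := by nlinarith [mul_nonneg hb0 hq'0]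
  have hQpos : 0 < Q := hqpos.trans_le hqQ
  have hden : (((P : ℚ) / Q : ℚ).den : ℤ) = Q :=
    Rat.den_div_eq_of_coprime hQpos (Int.isCoprime_iff_gcd_eq_one.mp hcop)
  have hdenR : (((P : ℚ) / Q : ℚ).den : ℝ) = Q := by exact_mod_cast hden
  refine ⟨(P : ℚ) / Q, ?_, ?_, ?_⟩
  · zify
    rw [hden]
    omega
  · zify
    rw [hden]
    exact hdvd
  · rw [hdenR]
    push_cast
    have hqR : (0 : ℝ) < q := by exact_mod_cast hqpos
    have hQR : (0 : ℝ) < Q := by exact_mod_cast hQpos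
    have hmR : (0 : ℝ) < m := by exact_mod_cast hm
    have hdetR : (p : ℝ) * q' - p' * q = 1 := by exact_mod_cast hdet
    have hQleR : (Q : ℝ) ≤ 2 * m * q := by exact_mod_cast hQle
    have haR : (0 : ℝ) ≤ a := by exact_mod_cast (by omega : (0 : ℤ) ≤ a)
    have hamR : (a : ℝ) ≤ m := by exact_mod_cast ham
    have hbR : (0 : ℝ) ≤ b := by exact_mod_cast hb0
    have hbmR : (b : ℝ) ≤ m := by exact_mod_cast hbm
    have hq'R : (0 : ℝ) ≤ q' := by exact_mod_cast hq'0
    have hq'qR : (q' : ℝ) ≤ q := by exact_mod_cast hq'.le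
    have hrR : (r : ℝ) = p / q := by
      rw [Rat.cast_def, hp, hq]
      norm_cast
    have hθ : |q * (q * α - p)| ≤ 1 := by
      have h1 : (q : ℝ) * (q * α - p) = q ^ 2 * (α - r) := by
        rw [hrR]
        field_simp
      have h2 : (r.den : ℝ) = q := by rw [hq]; norm_cast
      rw [h1, abs_mul, abs_of_nonneg (by positivity : (0 : ℝ) ≤ (q : ℝ) ^ 2)]
      rw [h2, le_div_iff₀ (by positivity)] at hr
      linarith
    set θ := (q : ℝ) * (q * α - p)
    have hθ' : |q * (q' * α - p')| ≤ 2 := by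
      have h1 : (q : ℝ) * (q' * α - p') = q' / q * θ + 1 := by
        simp only [θ]
        field_simp
        linear_combination hdetR
      have h2 : (q' : ℝ) / q ≤ 1 := (div_le_one hqR).mpr hq'qR
      have h3 : |q' / q * θ| ≤ 1 := by
        rw [abs_mul, abs_of_nonneg (by positivity : (0 : ℝ) ≤ (q' : ℝ) / q)]
        nlinarith [abs_nonneg θ]
      rw [h1]
      exact (abs_add_le _ _).trans (by rw [abs_one]; linarith)
    set θ' := (q : ℝ) * (q' * α - p')
    have hsum : |a * θ + b * θ'| ≤ 3 * m := by
      refine (abs_add_le _ _).trans ?_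
      rw [abs_mul (a : ℝ), abs_mul (b : ℝ), abs_of_nonneg haR, abs_of_nonneg hbR]
      nlinarith [abs_nonneg θ, abs_nonneg θ']
    have hkey : α - P / Q = (a * θ + b * θ') / (q * Q) := by
      have hQdef : (Q : ℝ) = a * q + b * q' := by rw [hQ]; push_cast; ring
      have hPdef : (P : ℝ) = a * p + b * p' := by rw [hP]; push_cast; ring
      simp only [θ, θ']
      rw [eq_div_iff (by positivity), sub_mul, mul_comm (q : ℝ) (Q : ℝ), ← mul_assoc,
        ← mul_assoc, div_mul_cancel₀ _ hQR.ne', hPdef, hQdef]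
      ring
    rw [hkey, abs_div, abs_of_pos (mul_pos hqR hQR), div_lt_div_iff₀ (by positivity) (by positivity)]
    calc |a * θ + b * θ'| * (Q : ℝ) ^ 2 ≤ 3 * m * (Q * (2 * m * q)) := by
          rw [sq]; gcongr
      _ = 6 * m ^ 2 * (q * Q) := by ring
      _ < 7 * m ^ 2 * (q * Q) := by gcongr; norm_num

/-- By Cassels's lemma the constant in the approximation can be made arbitrarily small, at the
cost of a null set. -/
lemma ae_exists_rat_dvd_den_abs_sub_lt {m : ℕ} (hm : 0 < m) {ε : ℝ} (hε : 0 < ε) :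
    ∀ᵐ α : ℝ, ∀ N : ℕ,
      ∃ r : ℚ, N ≤ r.den ∧ m ∣ r.den ∧ |α - r| < ε / (r.den : ℝ) ^ 2 := by
  let s : ℕ → Set ℝ := fun n => {x | ∃ r : ℚ, r.den = n ∧ x = r}
  have mem_iff (c : ℝ) (x : ℝ) :
      x ∈ blimsup (fun n : ℕ => Metric.thickening (c / (n : ℝ) ^ 2) (s n)) atTop (m ∣ ·) ↔
        ∀ N : ℕ, ∃ r : ℚ, N ≤ r.den ∧ m ∣ r.den ∧ |x - r| < c / (r.den : ℝ) ^ 2 := by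
    simp only [blimsup_eq_iInf_biSup_of_nat, Set.iInf_eq_iInter, Set.iSup_eq_iUnion,
      Set.mem_iInter, Set.mem_iUnion, Metric.mem_thickening_iff]
    refine forall_congr' fun N => ⟨?_, ?_⟩
    · rintro ⟨_, ⟨hdvd, hN⟩, _, ⟨r, rfl, rfl⟩, h⟩
      exact ⟨r, hN, hdvd, h⟩
    · rintro ⟨r, hN, hdvd, h⟩
      exact ⟨r.den, ⟨hdvd, hN⟩, r, ⟨r, rfl, rfl⟩, h⟩
  have hlim : Tendsto (fun n : ℕ => ε / (n : ℝ) ^ 2) atTop (nhds 0) :=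
    tendsto_const_nhds.div_atTop
      ((tendsto_pow_atTop two_ne_zero).comp tendsto_natCast_atTop_atTop)
  have hM : 0 < 7 * (m : ℝ) ^ 2 / ε := by positivity
  have hae := blimsup_thickening_mul_ae_eq (volume : Measure ℝ) (m ∣ ·) s hM _ hlim
  filter_upwards [hae.mem_iff, (Set.countable_range (Rat.cast : ℚ → ℝ)).ae_notMem volume]
    with α h hα
  have heq : ∀ n : ℕ, 7 * (m : ℝ) ^ 2 / ε * (ε / (n : ℝ) ^ 2) = 7 * (m : ℝ) ^ 2 / (n : ℝ) ^ 2 :=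
    fun n => by field_simp
  simp only [heq] at h
  rw [← mem_iff, ← h, mem_iff]
  exact exists_rat_dvd_den_abs_sub_lt_of_irrational hα hm

namespace GenContFract

lemma exists_int_eq_contsAux_of (α : ℝ) (n : ℕ) :
    ∃ A B : ℤ, (GenContFract.of α).contsAux n = ⟨(A : ℝ), (B : ℝ)⟩ := by
  induction n using Nat.strong_induction_on with
  | _ n ih =>
    match n with
    | 0 => exact ⟨1, 0, by simp [contsAux]⟩
    | 1 => exact ⟨⌊α⌋, 1, by simp [contsAux]⟩
    | n + 2 =>
      obtain ⟨A, B, h⟩ := ih n (by omega)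
      obtain ⟨A', B', h'⟩ := ih (n + 1) (by omega)
      cases hs : (GenContFract.of α).s.get? n with
      | none => exact ⟨A', B', by simp [contsAux, hs, h']⟩
      | some gp =>
        obtain ⟨h1, z, hz⟩ := of_partNum_eq_one_and_exists_int_partDen_eq hs
        refine ⟨z * A' + A, z * B' + B, ?_⟩
        rw [contsAux_recurrence hs h h']
        simp [h1, hz]

lemma exists_int_eq_nums_dens_of (α : ℝ) (n : ℕ) :
    ∃ A B : ℤ, (GenContFract.of α).nums n = A ∧ (GenContFract.of α).dens n = B := by
  obtain ⟨A, B, h⟩ := exists_int_eq_contsAux_of α (n + 1)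
  exact ⟨A, B, by rw [num_eq_conts_a, nth_cont_eq_succ_nth_contAux, h],
    by rw [den_eq_conts_b, nth_cont_eq_succ_nth_contAux, h]⟩

lemma monotone_dens_of (α : ℝ) : Monotone (GenContFract.of α).dens :=
  monotone_nat_of_le_succ fun _ => of_den_mono

/-- The `n`-th continuant of an irrational number is the reduced denominator of its `n`-th
convergent. -/
lemma dens_of_eq_den_of_convs_eq {α : ℝ} (hα : Irrational α) {n : ℕ} {r : ℚ}
    (h : (GenContFract.of α).convs n = r) : (GenContFract.of α).dens n = r.den := by
  obtain ⟨A, B, hA, hB⟩ := exists_int_eq_nums_dens_of α n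
  obtain ⟨A', B', hA', hB'⟩ := exists_int_eq_nums_dens_of α (n + 1)
  have hterm : ¬ (GenContFract.of α).TerminatedAt n := fun ht => by
    obtain ⟨q, hq⟩ := exists_rat_eq_of_terminates ⟨n, ht⟩
    exact hα.ne_rat q hq
  have hdet : A * B' - B * A' = (-1) ^ (n + 1) := by
    have := SimpContFract.determinant (s := SimpContFract.of α) hterm
    change (GenContFract.of α).nums n * (GenContFract.of α).dens (n + 1) - (GenContFract.of α).dens n * (GenContFract.of α).nums (n + 1) = _ at this
    rw [hA, hB, hA', hB'] at this
    exact_mod_cast this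
  have hBpos : 0 < B := by
    have h1 := monotone_dens_of α (Nat.zero_le n)
    rw [zeroth_den_eq_one, hB] at h1
    have h2 : (1 : ℤ) ≤ B := by exact_mod_cast h1
    omega
  have hcop : IsCoprime A B := by
    refine ⟨(-1) ^ (n + 1) * B', -(-1) ^ (n + 1) * A', ?_⟩
    have hsq : ((-1 : ℤ) ^ (n + 1)) * (-1) ^ (n + 1) = 1 := by rw [← mul_pow]; simp
    linear_combination (-1) ^ (n + 1) * hdet + hsq
  have hr : r = (A : ℚ) / B := by
    rw [conv_eq_num_div_den, hA, hB] at h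
    exact_mod_cast h.symm
  have := Rat.den_div_eq_of_coprime hBpos (Int.isCoprime_iff_gcd_eq_one.mp hcop)
  rw [hB, hr]
  exact_mod_cast this.symm

lemma exists_dens_of_eq_den_of_abs_sub_lt {α : ℝ} (hα : Irrational α) {r : ℚ}
    (h : |α - r| < 1 / (2 * (r.den : ℝ) ^ 2)) : ∃ n, (GenContFract.of α).dens n = r.den := by
  obtain ⟨n, hn⟩ := Real.exists_convs_eq_rat h
  exact ⟨n, dens_of_eq_den_of_convs_eq hα hn⟩

end GenContFract

lemma UnitAddCircle.den_mul_norm_lt {α ε : ℝ} {r : ℚ} (h : |α - r| < ε / (r.den : ℝ) ^ 2) :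
    (r.den : ℝ) * ‖((r.den * α : ℝ) : UnitAddCircle)‖ < ε := by
  have hd : (0 : ℝ) < r.den := by exact_mod_cast r.pos
  rw [UnitAddCircle.norm_eq]
  have h1 := round_le ((r.den : ℝ) * α) r.num
  have h2 : (r.den : ℝ) * α - r.num = r.den * (α - r) := by
    conv_rhs => rw [Rat.cast_def]
    field_simp
  rw [h2, abs_mul, abs_of_pos hd] at h1
  rw [lt_div_iff₀ (by positivity)] at h
  nlinarith

/-- Lebesgue-almost every `α ∈ ℝ` is irrational and divisible: there is a
strictly increasing sequence of indices `(n_j)` such that the continuants `q_{n_j}`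
(denominators of the convergents of the continued fraction expansion of `α`) satisfy
`2q_{n_j} ∣ q_{n_{j+1}}` for every `j` and `q_{n_j}·‖q_{n_j}α‖ → 0`. -/
theorem statement12 :
    ∀ᵐ α ∂(volume : Measure ℝ), Irrational α ∧
      ∃ idx : ℕ → ℕ, StrictMono idx ∧
        (∀ j : ℕ, ∃ c : ℕ,
          (GenContFract.of α).dens (idx (j + 1))
            = 2 * (GenContFract.of α).dens (idx j) * (c : ℝ)) ∧
        Filter.Tendsto (fun j : ℕ => (GenContFract.of α).dens (idx j) *
            ‖(((GenContFract.of α).dens (idx j) * α : ℝ) : UnitAddCircle)‖)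
          Filter.atTop (nhds 0) := by
  have hall : ∀ᵐ α : ℝ, ∀ m k N : ℕ, ∃ r : ℚ, N ≤ r.den ∧ (m + 1) ∣ r.den ∧
      |α - r| < 1 / ((k : ℝ) + 2) / (r.den : ℝ) ^ 2 :=
    ae_all_iff.mpr fun m => ae_all_iff.mpr fun k =>
      ae_exists_rat_dvd_den_abs_sub_lt m.succ_pos (by positivity)
  filter_upwards [hall, (Set.countable_range (Rat.cast : ℚ → ℝ)).ae_notMem volume]
    with α h hα
  replace hα : Irrational α := hα
  refine ⟨hα, ?_⟩
  set d := (GenContFract.of α).dens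
  have step : ∀ k n : ℕ, ∃ n', n < n' ∧ (∃ c : ℕ, d n' = 2 * d n * c) ∧
      d n' * ‖((d n' * α : ℝ) : UnitAddCircle)‖ < 1 / ((k : ℝ) + 1) := by
    intro k n
    obtain ⟨-, B, -, hB⟩ := GenContFract.exists_int_eq_nums_dens_of α n
    have hB1 : 1 ≤ B := by
      have h1 := GenContFract.monotone_dens_of α (Nat.zero_le n)
      rw [GenContFract.zeroth_den_eq_one, hB] at h1
      exact_mod_cast h1
    lift B to ℕ using by omega
    norm_cast at hB1
    obtain ⟨r, hN, hdvd, hr⟩ := h (2 * B - 1) k (B + 1)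
    have hd : (0 : ℝ) < r.den := by exact_mod_cast r.pos
    obtain ⟨n', hn'⟩ := GenContFract.exists_dens_of_eq_den_of_abs_sub_lt hα (r := r) <| by
      refine hr.trans_le ?_
      rw [div_div]
      gcongr
      linarith [k.cast_nonneg (α := ℝ)]
    refine ⟨n', ?_, ?_, ?_⟩
    · by_contra! hle
      have h1 := GenContFract.monotone_dens_of α hle
      rw [hn', hB] at h1
      have : r.den ≤ B := by exact_mod_cast h1
      omega
    · rw [show 2 * B - 1 + 1 = 2 * B by omega] at hdvd
      obtain ⟨c, hc⟩ := hdvd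
      refine ⟨c, ?_⟩
      simp only [d]
      rw [hn', hB, hc]
      push_cast
      ring
    · simp only [d]
      rw [hn']
      refine (UnitAddCircle.den_mul_norm_lt hr).trans ?_
      gcongr
      norm_num
  choose f hlt hdvd hsmall using step
  let idx : ℕ → ℕ := fun j => Nat.rec 0 f j
  refine ⟨idx, strictMono_nat_of_lt_succ fun j => hlt j _, fun j => hdvd j _, ?_⟩
  rw [← tendsto_add_atTop_iff_nat 1]
  refine squeeze_zero (fun j => mul_nonneg GenContFract.zero_le_of_den (norm_nonneg _))
    (fun j => (hsmall j (idx j)).le) tendsto_one_div_add_atTop_nhds_zero_nat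
end

section
/- Define the continuant K recursively by K() = 1, K(a_1) = a_1, and K(a_1, …, a_m) = a_m·K(a_1, …, a_{m−1}) + K(a_1, …, a_{m−2}) for m ≥ 2. Let n ≥ 3, let a_1, …, a_{n−1} and q be positive integers. Then there exist integers a and b such that for all positive integers a_n, a_{n+1} with a_n ≡ a (mod q) and a_{n+1} ≡ b (mod q), q divides K(a_1, …, a_{n−1}, a_n, a_{n+1}). -/
/-- The continuant `K(a_1, …, a_m)` of the sequence `a 1, a 2, …` (index `0` is unused):
`K() = 1`, `K(a_1) = a_1`, and
`K(a_1, …, a_m) = a_m·K(a_1, …, a_{m-1}) + K(a_1, …, a_{m-2})`. -/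
def contK (a : ℕ → ℕ) : ℕ → ℕ
  | 0 => 1
  | 1 => a 1
  | (m + 2) => a (m + 2) * contK a (m + 1) + contK a m

/-- The continuant of length `m` depends only on the entries `a 1, …, a m`. -/
theorem contK_congr {a b : ℕ → ℕ} (m : ℕ) (h : ∀ i, 1 ≤ i → i ≤ m → a i = b i) :
    contK a m = contK b m := by
  induction m using Nat.twoStepInduction with
  | zero => rfl
  | one => exact h 1 le_rfl le_rfl
  | more m ih₀ ih₁ =>
    simp only [contK]
    rw [h (m + 2) (by omega) le_rfl, ih₀ fun i h₁ h₂ => h i h₁ (by omega),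
      ih₁ fun i h₁ h₂ => h i h₁ (by omega)]

theorem contK_pos {a : ℕ → ℕ} (m : ℕ) (h : ∀ i, 1 ≤ i → i ≤ m → 0 < a i) : 0 < contK a m := by
  induction m using Nat.twoStepInduction with
  | zero => exact Nat.one_pos
  | one => exact h 1 le_rfl le_rfl
  | more m ih₀ ih₁ => exact Nat.add_pos_right _ (ih₀ fun i h₁ h₂ => h i h₁ (by omega))

theorem contK_coprime_succ (a : ℕ → ℕ) (m : ℕ) :
    (contK a m).Coprime (contK a (m + 1)) := by
  induction m with
  | zero => exact Nat.coprime_one_left _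
  | succ m ih => simpa [contK] using ih.symm

/-- A residue class coprime to its modulus `x` contains integers coprime to any given `q`. -/
theorem exists_isCoprime_mul_add {x y q : ℕ} (hx : 0 < x) (hq : 0 < q) (h : y.Coprime x) :
    ∃ A : ℤ, IsCoprime (A * x + y) (q : ℤ) := by
  obtain ⟨p, hpq, hp, hmod⟩ := Nat.forall_exists_prime_gt_and_modEq q hx.ne' h
  obtain ⟨A, hA⟩ := Nat.modEq_iff_dvd.mp hmod.symm
  refine ⟨A, ?_⟩
  have hp_eq : A * x + y = (p : ℤ) := by linear_combination -hA
  rw [hp_eq, Nat.isCoprime_iff_coprime]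
  exact Nat.coprime_of_lt_prime hq.ne' hpq hp

/-- for `n ≥ 3`, positive integers `a_1, …, a_{n-1}` and a positive integer
`q`, there are integers `a`, `b` such that whenever the entries `a_n ≡ a (mod q)` and
`a_{n+1} ≡ b (mod q)` are positive integers, `q` divides `K(a_1, …, a_n, a_{n+1})`. -/
theorem statement13 (n : ℕ) (hn : 3 ≤ n) (a : ℕ → ℕ) (ha : ∀ i, 1 ≤ i → i ≤ n - 1 → 0 < a i)
    (q : ℕ) (hq : 0 < q) :
    ∃ A B : ℤ, ∀ a' : ℕ → ℕ,
      (∀ i, 1 ≤ i → i ≤ n - 1 → a' i = a i) →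
      0 < a' n → 0 < a' (n + 1) →
      (a' n : ℤ) ≡ A [ZMOD (q : ℤ)] → (a' (n + 1) : ℤ) ≡ B [ZMOD (q : ℤ)] →
      q ∣ contK a' (n + 1) := by
  obtain ⟨k, rfl⟩ : ∃ k, n = k + 2 := ⟨n - 2, by omega⟩
  rw [show k + 2 - 1 = k + 1 by omega] at *
  obtain ⟨A, u, v, huv⟩ :=
    exists_isCoprime_mul_add (contK_pos (k + 1) ha) hq (contK_coprime_succ a k)
  refine ⟨A, -(contK a (k + 1) * u), fun a' haa' _ _ hA hB => ?_⟩
  rw [← Int.natCast_dvd_natCast, ← Int.modEq_zero_iff_dvd]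
  have h₁ : contK a' (k + 1) = contK a (k + 1) := contK_congr _ haa'
  have h₀ : contK a' k = contK a k := contK_congr _ fun i hi hik => haa' i hi (by omega)
  have hK : contK a' (k + 2 + 1) =
      a' (k + 2 + 1) * (a' (k + 2) * contK a (k + 1) + contK a k) + contK a (k + 1) := by
    simp only [contK, h₁, h₀]
  rw [hK]
  push_cast
  refine ((hB.mul ((hA.mul_right _).add_right _)).add_right _).trans ?_
  rw [Int.modEq_zero_iff_dvd]
  exact ⟨contK a (k + 1) * v, by linear_combination -(contK a (k + 1) : ℤ) * huv⟩
end
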